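/- Choice of convex integration control parameters: let α > 0, κ > 1/2, γ < 3/2, ν ∈ ℝ. Then for every C > 1 there exist a, b ∈ ℕ with a, b ≥ 2 and β ∈ (0,1) such that for all C_z ≥ 0, all C_start ≥ 1, and all n ≥ 1, the parameters defined below satisfy: (R1) μ_n ≤ λ_n; (R2) ℓ_n ≤ 1; (R3) 12 λ_{n−1} ≤ 4 μ_n, 10 ≤ μ_n, and 48 λ_{n−1} ≤ λ_n; and C·(𝔈_n^{miss} + 𝔈_n^{com} + 𝔈_n^{time} + 𝔈_n^{dis} + 𝔈_n^{trans} + 𝔈_n^{sto}) ≤ r_n. -/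

import Mathlib

/-- Frequency parameter `λ_n = a^(b^n)`. -/
noncomputable def lamPar (a b n : ℕ) : ℝ := (a : ℝ) ^ (b ^ n)

/-- Concentration parameter `r_n = C_start (C_z² + 1) λ_0^β λ_n^{−β}`. -/
noncomputable def rPar (a b : ℕ) (βp Cstart Cz : ℝ) (n : ℕ) : ℝ :=
  Cstart * (Cz ^ 2 + 1) * lamPar a b 0 ^ βp * lamPar a b n ^ (-βp)

/-- Mollification parameter `ℓ_n = λ_n^{−1}`. -/
noncomputable def ellPar (a b n : ℕ) : ℝ := (lamPar a b n)⁻¹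

/-- Intermediate frequency parameter `μ_n = √(λ_{n−1} λ_n)`. -/
noncomputable def muPar (a b n : ℕ) : ℝ := Real.sqrt (lamPar a b (n - 1) * lamPar a b n)

/-- Accumulated building block sum `𝔖_{N,α} = Σ_{k=1}^{N} 4^{N−k} ℓ_k^{−α} r_{k−1}^{1/2}`. -/
noncomputable def SPar (a b : ℕ) (βp Cstart Cz α : ℝ) (N : ℕ) : ℝ :=
  ∑ k ∈ Finset.Icc 1 N,
    (4 : ℝ) ^ (N - k) * ellPar a b k ^ (-α) * rPar a b βp Cstart Cz (k - 1) ^ ((1 : ℝ) / 2)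

/-- Mismatch error `𝔈_n^{miss}`. -/
noncomputable def EMiss (a b : ℕ) (βp Cstart Cz : ℝ) (n : ℕ) : ℝ :=
  (Real.log (muPar a b n) *
      (lamPar a b (n - 1) / muPar a b n + muPar a b n / lamPar a b n) ^ 2 +
    lamPar a b (n - 1) / lamPar a b n) * rPar a b βp Cstart Cz (n - 1)

/-- Commutator error `𝔈_n^{com}`. -/
noncomputable def ECom (a b : ℕ) (βp Cstart Cz α κ : ℝ) (n : ℕ) : ℝ :=
  Real.log (lamPar a b n) * lamPar a b (n - 1) * ellPar a b n ^ α *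
      SPar a b βp Cstart Cz α (n - 1) * SPar a b βp Cstart Cz 0 (n - 1) +
    Real.log (lamPar a b n) * lamPar a b (n - 1) ^ ((1 : ℝ) / 2) *
      (ellPar a b n ^ α * SPar a b βp Cstart Cz α (n - 1) +
        lamPar a b (n - 1) ^ (-κ) * SPar a b βp Cstart Cz 0 (n - 1)) * Cz +
    Real.log (lamPar a b n) * (ellPar a b n ^ α + lamPar a b (n - 1) ^ (-κ)) * Cz ^ 2

/-- Time error `𝔈_n^{time}`. -/
noncomputable def ETime (a b : ℕ) (βp Cstart Cz : ℝ) (n : ℕ) : ℝ :=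
  Real.log (lamPar a b n) * lamPar a b n ^ (-(3 : ℝ) / 2) *
    rPar a b βp Cstart Cz (n - 1) ^ ((1 : ℝ) / 2) * (ellPar a b n)⁻¹

/-- Dissipation error `𝔈_n^{dis}`. -/
noncomputable def EDis (a b : ℕ) (βp Cstart Cz γ ν : ℝ) (n : ℕ) : ℝ :=
  Real.log (lamPar a b n) * |ν| * lamPar a b n ^ (γ - 3 / 2) *
    rPar a b βp Cstart Cz (n - 1) ^ ((1 : ℝ) / 4)

/-- Transport error `𝔈_n^{trans}`. -/
noncomputable def ETrans (a b : ℕ) (βp Cstart Cz : ℝ) (n : ℕ) : ℝ :=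
  Real.log (lamPar a b n) * lamPar a b (n - 1) ^ ((1 : ℝ) / 2) *
    lamPar a b n ^ (-(1 : ℝ) / 2) * rPar a b βp Cstart Cz (n - 1) ^ ((1 : ℝ) / 2) *
    SPar a b βp Cstart Cz 0 (n - 1)

/-- Stochastic error `𝔈_n^{sto}`. -/
noncomputable def ESto (a b : ℕ) (βp Cstart Cz : ℝ) (n : ℕ) : ℝ :=
  Real.log (lamPar a b n) * lamPar a b n ^ (-(1 : ℝ) / 2) *
    rPar a b βp Cstart Cz (n - 1) ^ ((1 : ℝ) / 2) * Cz

lemma lamPar_succ (a b n : ℕ) : lamPar a b (n + 1) = lamPar a b n ^ b := by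
  rw [lamPar, lamPar, pow_succ, pow_mul]

lemma lamPar_pos {a : ℕ} (ha : 0 < a) (b n : ℕ) : 0 < lamPar a b n := by
  unfold lamPar; positivity

lemma lamPar_mono {a b : ℕ} (ha : 1 ≤ a) (hb : 1 ≤ b) : Monotone (lamPar a b) := by
  intro k n hkn
  exact pow_le_pow_right₀ (by exact_mod_cast ha) (Nat.pow_le_pow_right hb hkn)

lemma lamPar_zero (a b : ℕ) : lamPar a b 0 = a := by simp [lamPar]

lemma pow_le_log_lamPar {a : ℕ} (ha : 3 ≤ a) (b n : ℕ) :
    (b : ℝ) ^ n ≤ Real.log (lamPar a b n) := by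
  have h3 : (3 : ℝ) ≤ a := by exact_mod_cast ha
  have h1 : 1 ≤ Real.log a := by
    rw [Real.le_log_iff_exp_le (by linarith)]
    linarith [Real.exp_one_lt_d9]
  rw [lamPar, Real.log_pow, Nat.cast_pow]
  exact le_mul_of_one_le_right (by positivity) h1

lemma rPar_nonneg {a b : ℕ} {βp Cstart : ℝ} (hC : 0 ≤ Cstart) (Cz : ℝ) (n : ℕ) :
    0 ≤ rPar a b βp Cstart Cz n := by
  unfold rPar lamPar; positivity

lemma rPar_le {a b : ℕ} {βp Cstart : ℝ} (ha : 1 ≤ a) (hb : 1 ≤ b) (hβ : 0 ≤ βp)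
    (hC : 0 ≤ Cstart) (Cz : ℝ) (n : ℕ) :
    rPar a b βp Cstart Cz n ≤ Cstart * (Cz ^ 2 + 1) := by
  have h0 := lamPar_pos ha b 0
  have hn := lamPar_pos ha b n
  have h : lamPar a b 0 ^ βp * lamPar a b n ^ (-βp) ≤ 1 := by
    rw [Real.rpow_neg hn.le, ← div_eq_mul_inv]
    exact div_le_one_of_le₀ (Real.rpow_le_rpow h0.le (lamPar_mono ha hb n.zero_le) hβ)
      (by positivity)
  rw [rPar, mul_assoc]
  exact mul_le_of_le_one_right (by positivity) h

lemma le_rPar {a b : ℕ} {βp Cstart : ℝ} (ha : 1 ≤ a) (hβ : 0 ≤ βp)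
    (hC : 0 ≤ Cstart) (Cz : ℝ) (n : ℕ) :
    Cstart * (Cz ^ 2 + 1) * lamPar a b n ^ (-βp) ≤ rPar a b βp Cstart Cz n := by
  have hn := lamPar_pos ha b n
  have h : 1 ≤ lamPar a b 0 ^ βp := by
    rw [lamPar_zero]
    exact Real.one_le_rpow (by exact_mod_cast ha) hβ
  unfold rPar
  rw [mul_right_comm (Cstart * (Cz ^ 2 + 1))]
  exact le_mul_of_one_le_right (by positivity) h

lemma SPar_nonneg {a b : ℕ} {βp Cstart : ℝ} (hC : 0 ≤ Cstart) (Cz α : ℝ) (N : ℕ) :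
    0 ≤ SPar a b βp Cstart Cz α N := by
  refine Finset.sum_nonneg fun k _ => ?_
  have := rPar_nonneg (a := a) (b := b) (βp := βp) hC Cz (k - 1)
  unfold ellPar lamPar
  positivity

lemma sum_Icc_four_pow_le (N : ℕ) : ∑ k ∈ Finset.Icc 1 N, (4 : ℝ) ^ (N - k) ≤ 4 ^ N - 1 := by
  induction N with
  | zero => simp
  | succ N ih =>
    have h : ∑ k ∈ Finset.Icc 1 N, (4 : ℝ) ^ (N + 1 - k)
        = 4 * ∑ k ∈ Finset.Icc 1 N, (4 : ℝ) ^ (N - k) := by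
      rw [Finset.mul_sum]
      refine Finset.sum_congr rfl fun k hk => ?_
      rw [Nat.sub_add_comm (Finset.mem_Icc.1 hk).2, pow_succ, mul_comm]
    rw [Finset.sum_Icc_succ_top (by omega), h, Nat.sub_self, pow_zero, pow_succ]
    linarith

lemma SPar_le {a b : ℕ} {βp Cstart α : ℝ} (ha : 3 ≤ a) (hb : 4 ≤ b) (hβ : 0 ≤ βp)
    (hC : 0 ≤ Cstart) (hα : 0 ≤ α) (Cz : ℝ) (N : ℕ) :
    SPar a b βp Cstart Cz α N ≤
      (Cstart * (Cz ^ 2 + 1)) ^ ((1 : ℝ) / 2) * Real.log (lamPar a b N) * lamPar a b N ^ α := by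
  have hN := lamPar_pos (show 0 < a by omega) b N
  calc SPar a b βp Cstart Cz α N
      ≤ ∑ k ∈ Finset.Icc 1 N, (4 : ℝ) ^ (N - k) *
          (lamPar a b N ^ α * (Cstart * (Cz ^ 2 + 1)) ^ ((1 : ℝ) / 2)) := by
        refine Finset.sum_le_sum fun k hk => ?_
        have hk0 := lamPar_pos (show 0 < a by omega) b k
        have hl : ellPar a b k ^ (-α) ≤ lamPar a b N ^ α := by
          rw [ellPar, Real.rpow_neg (by positivity), Real.inv_rpow hk0.le, inv_inv]
          exact Real.rpow_le_rpow hk0.le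
            (lamPar_mono (by omega) (by omega) (Finset.mem_Icc.1 hk).2) hα
        have hr0 := rPar_nonneg (a := a) (b := b) (βp := βp) hC Cz (k - 1)
        have hr := rPar_le (a := a) (b := b) (by omega) (by omega) hβ hC Cz (k - 1)
        rw [mul_assoc]
        gcongr
    _ = (∑ k ∈ Finset.Icc 1 N, (4 : ℝ) ^ (N - k)) *
          (lamPar a b N ^ α * (Cstart * (Cz ^ 2 + 1)) ^ ((1 : ℝ) / 2)) := by
        rw [Finset.sum_mul]
    _ ≤ Real.log (lamPar a b N) *
          (lamPar a b N ^ α * (Cstart * (Cz ^ 2 + 1)) ^ ((1 : ℝ) / 2)) := by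
        gcongr
        calc _ ≤ (4 : ℝ) ^ N := by linarith [sum_Icc_four_pow_le N]
          _ ≤ (b : ℝ) ^ N := by gcongr; exact_mod_cast hb
          _ ≤ _ := pow_le_log_lamPar ha b N
    _ = _ := by ring

lemma exists_nat_forall_log_pow_le (K : ℝ) {s : ℝ} (hs : 0 < s) (k : ℕ) :
    ∃ a : ℕ, 48 ≤ a ∧ ∀ x : ℝ, (a : ℝ) ≤ x → K * Real.log x ^ k ≤ x ^ s := by
  have h := ((isLittleO_log_rpow_rpow_atTop (k : ℝ) hs).const_mul_left K).bound one_pos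
  obtain ⟨x₀, hx₀⟩ := Filter.eventually_atTop.1 h
  refine ⟨max 48 ⌈x₀⌉₊, le_max_left _ _, fun x hx => ?_⟩
  push_cast at hx
  have hx48 : (48 : ℝ) ≤ x := (le_max_left _ _).trans hx
  have := hx₀ x ((Nat.le_ceil x₀).trans ((le_max_right _ _).trans hx))
  rw [one_mul, Real.norm_eq_abs, Real.norm_eq_abs, Real.rpow_natCast,
    abs_of_nonneg (Real.rpow_nonneg (by linarith) s)] at this
  exact (le_abs_self _).trans this

/-- The real powers of consecutive frequencies. -/
lemma lamPar_succ_rpow {a : ℕ} (ha : 0 < a) (b n : ℕ) (s : ℝ) :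
    lamPar a b (n + 1) ^ s = lamPar a b n ^ (b * s) := by
  rw [lamPar_succ, Real.rpow_mul (lamPar_pos ha b n).le, Real.rpow_natCast]

lemma log_lamPar_succ (a b n : ℕ) :
    Real.log (lamPar a b (n + 1)) = b * Real.log (lamPar a b n) := by
  rw [lamPar_succ, Real.log_pow]

lemma one_le_log_lamPar {a b : ℕ} (ha : 3 ≤ a) (hb : 1 ≤ b) (n : ℕ) :
    1 ≤ Real.log (lamPar a b n) :=
  (one_le_pow₀ (by exact_mod_cast hb)).trans (pow_le_log_lamPar ha b n)

lemma one_le_lamPar {a : ℕ} (ha : 1 ≤ a) (b n : ℕ) : 1 ≤ lamPar a b n :=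
  one_le_pow₀ (by exact_mod_cast ha)

lemma rPar_rpow_le {a b : ℕ} {βp Cstart s t : ℝ} (ha : 1 ≤ a) (hb : 1 ≤ b) (hβ : 0 ≤ βp)
    (hC : 1 ≤ Cstart) (hs : 0 ≤ s) (hst : s ≤ t) (Cz : ℝ) (n : ℕ) :
    rPar a b βp Cstart Cz n ^ s ≤ (Cstart * (Cz ^ 2 + 1)) ^ t :=
  (Real.rpow_le_rpow (rPar_nonneg (by linarith) Cz n)
    (rPar_le ha hb hβ (by linarith) Cz n) hs).trans
    (Real.rpow_le_rpow_of_exponent_le (by nlinarith [sq_nonneg Cz]) hst)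

lemma le_sqrt_amplitude {Cstart Cz : ℝ} (hC : 1 ≤ Cstart) :
    Cz ≤ (Cstart * (Cz ^ 2 + 1)) ^ ((1 : ℝ) / 2) := by
  rw [← Real.sqrt_eq_rpow]
  exact Real.le_sqrt_of_sq_le (by nlinarith [sq_nonneg Cz])

lemma rpow_half_mul_self {M : ℝ} (hM : 0 ≤ M) :
    M ^ ((1 : ℝ) / 2) * M ^ ((1 : ℝ) / 2) = M := by
  rw [← Real.sqrt_eq_rpow, Real.mul_self_sqrt hM]

lemma EMiss_succ_le {a b : ℕ} {βp Cstart δ : ℝ} (ha : 3 ≤ a) (hb : 4 ≤ b) (hβ : 0 ≤ βp)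
    (hC : 0 ≤ Cstart) (hδ : δ ≤ 1) (Cz : ℝ) (N : ℕ) :
    EMiss a b βp Cstart Cz (N + 1) ≤
      5 * (b * Real.log (lamPar a b N) ^ 3 * lamPar a b N ^ (-δ) * (Cstart * (Cz ^ 2 + 1))) := by
  have hb4 : (4 : ℝ) ≤ b := by exact_mod_cast hb
  have hL := one_le_log_lamPar ha (show 1 ≤ b by omega) N
  have hX1 := one_le_lamPar (show 1 ≤ a by omega) b N
  have hdiv : lamPar a b N / lamPar a b (N + 1) ≤ lamPar a b N ^ (-δ) := by
    rw [div_eq_mul_inv, ← Real.rpow_neg_one (lamPar a b (N + 1)), lamPar_succ_rpow (by omega)]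
    nth_rewrite 1 [← Real.rpow_one (lamPar a b N)]
    rw [← Real.rpow_add (by linarith)]
    exact Real.rpow_le_rpow_of_exponent_le hX1 (by linarith)
  have hlogs := log_lamPar_succ a b N
  have hX := lamPar_pos (show 0 < a by omega) b N
  have hY := lamPar_pos (show 0 < a by omega) b (N + 1)
  have hXY := lamPar_mono (show 1 ≤ a by omega) (show 1 ≤ b by omega) N.le_succ
  have hr := rPar_le (a := a) (b := b) (by omega) (by omega) hβ hC Cz N
  have hr0 := rPar_nonneg (a := a) (b := b) (βp := βp) hC Cz N
  unfold EMiss muPar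
  simp only [Nat.add_sub_cancel]
  set X := lamPar a b N
  set Y := lamPar a b (N + 1)
  have hμ : Real.sqrt (X * Y) ^ 2 = X * Y := Real.sq_sqrt (by positivity)
  have hμ0 : 0 < Real.sqrt (X * Y) := Real.sqrt_pos.2 (by positivity)
  have hμY : Real.sqrt (X * Y) ≤ Y := Real.sqrt_le_iff.2 ⟨hY.le, by nlinarith⟩
  have hlog : Real.log (Real.sqrt (X * Y)) ≤ Real.log Y := Real.log_le_log hμ0 hμY
  have hsq : (X / Real.sqrt (X * Y) + Real.sqrt (X * Y) / Y) ^ 2 = 4 * (X / Y) := by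
    have : X / Real.sqrt (X * Y) = Real.sqrt (X * Y) / Y := by
      rw [div_eq_div_iff hμ0.ne' hY.ne', ← sq, hμ]
    rw [this, ← two_mul, mul_pow, div_pow, hμ]
    field_simp
    norm_num
  have hlogY : 0 ≤ Real.log Y := le_trans (by positivity) (pow_le_log_lamPar ha b (N + 1))
  rw [hsq]
  calc _ ≤ (Real.log Y * (4 * (X / Y)) + X / Y) * (Cstart * (Cz ^ 2 + 1)) := by gcongr
    _ = (4 * (b * Real.log X) + 1) * (X / Y) * (Cstart * (Cz ^ 2 + 1)) := by rw [hlogs]; ring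
    _ ≤ (5 * (b * Real.log X ^ 3)) * X ^ (-δ) * (Cstart * (Cz ^ 2 + 1)) := by
        have h3 : Real.log X ≤ Real.log X ^ 3 := le_self_pow₀ hL (by norm_num)
        have : (b : ℝ) * Real.log X ≤ b * Real.log X ^ 3 := by gcongr
        gcongr
        nlinarith
    _ = _ := by ring

lemma ECom_succ_le {a b : ℕ} {βp Cstart Cz α κ δ : ℝ} (ha : 3 ≤ a) (hb : 4 ≤ b) (hβ : 0 ≤ βp)
    (hC : 1 ≤ Cstart) (hCz : 0 ≤ Cz) (hα : 0 ≤ α) (hδ : δ ≤ 1) (hδκ : δ ≤ κ - 1 / 2)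
    (hbα : 2 + α ≤ b * α) (N : ℕ) :
    ECom a b βp Cstart Cz α κ (N + 1) ≤
      5 * (b * Real.log (lamPar a b N) ^ 3 * lamPar a b N ^ (-δ) * (Cstart * (Cz ^ 2 + 1))) := by
  have hL := one_le_log_lamPar ha (show 1 ≤ b by omega) N
  have hX := one_le_lamPar (show 1 ≤ a by omega) b N
  have hSα := SPar_le (a := a) (b := b) ha hb hβ (zero_le_one.trans hC) hα Cz N
  have hS0 := SPar_le (a := a) (b := b) ha hb hβ (zero_le_one.trans hC) le_rfl Cz N
  have hSα' := SPar_nonneg (a := a) (b := b) (βp := βp) (show 0 ≤ Cstart by linarith) Cz α N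
  have hS0' := SPar_nonneg (a := a) (b := b) (βp := βp) (show 0 ≤ Cstart by linarith) Cz 0 N
  have hCzm := le_sqrt_amplitude (Cz := Cz) hC
  have hM1 : 1 ≤ Cstart * (Cz ^ 2 + 1) := by nlinarith [sq_nonneg Cz]
  have hmm := rpow_half_mul_self (zero_le_one.trans hM1)
  have hl : ellPar a b (N + 1) ^ α = lamPar a b N ^ (b * -α) := by
    rw [ellPar, ← lamPar_succ_rpow (by omega), Real.rpow_neg (lamPar_pos (by omega) b _).le,
      Real.inv_rpow (lamPar_pos (by omega) b _).le]
  unfold ECom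
  simp only [Nat.add_sub_cancel, hl, log_lamPar_succ, Real.rpow_zero, mul_one] at hS0 ⊢
  set X := lamPar a b N
  set L := Real.log X
  set M := Cstart * (Cz ^ 2 + 1)
  set m := M ^ ((1 : ℝ) / 2)
  set A := SPar a b βp Cstart Cz α N
  set B := SPar a b βp Cstart Cz 0 N
  have hX0 : 0 < X := by linarith
  have hM0 : 0 < M := by linarith
  have hm0 : 0 < m := by positivity
  have hL0 : 0 < L := by linarith
  have hL13 : L ≤ L ^ 3 := le_self_pow₀ hL (by norm_num)
  have hL23 : L ^ 2 ≤ L ^ 3 := pow_le_pow_right₀ hL (by norm_num)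
  have h1 : b * L * X * X ^ (b * -α) * A * B ≤ b * L ^ 3 * X ^ (-δ) * M := by
    calc _ ≤ b * L * X * X ^ (b * -α) * (m * L * X ^ α) * (m * L) := by gcongr
      _ = b * L ^ 3 * (X ^ (1 : ℝ) * X ^ (b * -α) * X ^ α) * (m * m) := by
          rw [Real.rpow_one]; ring
      _ = b * L ^ 3 * X ^ (1 + b * -α + α) * M := by
          rw [hmm, ← Real.rpow_add hX0, ← Real.rpow_add hX0]
      _ ≤ _ := by
          gcongr
          linarith
  have h2 : b * L * X ^ ((1 : ℝ) / 2) * (X ^ (b * -α) * A + X ^ (-κ) * B) * Cz ≤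
      2 * (b * L ^ 3 * X ^ (-δ) * M) := by
    calc _ ≤ b * L * X ^ ((1 : ℝ) / 2) *
          (X ^ (b * -α) * (m * L * X ^ α) + X ^ (-κ) * (m * L)) * m := by gcongr
      _ = b * L ^ 2 * (X ^ ((1 : ℝ) / 2) * X ^ (b * -α) * X ^ α + X ^ ((1 : ℝ) / 2) * X ^ (-κ))
            * (m * m) := by ring
      _ = b * L ^ 2 * (X ^ (1 / 2 + b * -α + α) + X ^ (1 / 2 + -κ)) * M := by
          rw [hmm, ← Real.rpow_add hX0, ← Real.rpow_add hX0, ← Real.rpow_add hX0]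
      _ ≤ b * L ^ 3 * (X ^ (-δ) + X ^ (-δ)) * M := by
          gcongr
          · linarith
          · linarith
      _ = _ := by ring
  have h3 : b * L * (X ^ (b * -α) + X ^ (-κ)) * Cz ^ 2 ≤ 2 * (b * L ^ 3 * X ^ (-δ) * M) := by
    calc _ ≤ b * L ^ 3 * (X ^ (-δ) + X ^ (-δ)) * M := by
          have : Cz ^ 2 ≤ M := by rw [← hmm, sq]; gcongr
          gcongr
          · linarith
          · linarith
      _ = _ := by ring
  linarith

lemma ETime_succ_le {a b : ℕ} {βp Cstart δ : ℝ} (ha : 3 ≤ a) (hb : 4 ≤ b) (hβ : 0 ≤ βp)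
    (hC : 1 ≤ Cstart) (hδ : δ ≤ 1) (Cz : ℝ) (N : ℕ) :
    ETime a b βp Cstart Cz (N + 1) ≤
      b * Real.log (lamPar a b N) ^ 3 * lamPar a b N ^ (-δ) * (Cstart * (Cz ^ 2 + 1)) := by
  have hb4 : (4 : ℝ) ≤ b := by exact_mod_cast hb
  have hL := one_le_log_lamPar ha (show 1 ≤ b by omega) N
  have hX := one_le_lamPar (show 1 ≤ a by omega) b N
  have hY := lamPar_pos (show 0 < a by omega) b (N + 1)
  have hr := rPar_rpow_le (a := a) (b := b) (s := 1 / 2) (t := 1) (by omega) (by omega) hβ hC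
    (by norm_num) (by norm_num) Cz N
  have hr0 := rPar_nonneg (a := a) (b := b) (βp := βp) (zero_le_one.trans hC) Cz N
  have hL13 : Real.log (lamPar a b N) ≤ Real.log (lamPar a b N) ^ 3 :=
    le_self_pow₀ hL (by norm_num)
  have hpow : lamPar a b (N + 1) ^ (-(3 : ℝ) / 2) * lamPar a b (N + 1) ≤
      lamPar a b N ^ (-δ) := by
    nth_rewrite 2 [← Real.rpow_one (lamPar a b (N + 1))]
    rw [← Real.rpow_add hY, lamPar_succ_rpow (by omega)]
    exact Real.rpow_le_rpow_of_exponent_le hX (by linarith)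
  rw [Real.rpow_one] at hr
  unfold ETime ellPar
  simp only [Nat.add_sub_cancel, inv_inv]
  calc _ = b * Real.log (lamPar a b N) * (lamPar a b (N + 1) ^ (-(3 : ℝ) / 2) *
        lamPar a b (N + 1)) * rPar a b βp Cstart Cz N ^ ((1 : ℝ) / 2) := by
        rw [log_lamPar_succ]; ring
    _ ≤ _ := by gcongr

lemma EDis_succ_le {a b : ℕ} {βp Cstart δ γ : ℝ} (ha : 3 ≤ a) (hb : 4 ≤ b) (hβ : 0 ≤ βp)
    (hC : 1 ≤ Cstart) (hγ : γ ≤ 3 / 2) (hδ : δ ≤ 3 / 2 - γ) (ν Cz : ℝ) (N : ℕ) :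
    EDis a b βp Cstart Cz γ ν (N + 1) ≤
      |ν| *
        (b * Real.log (lamPar a b N) ^ 3 * lamPar a b N ^ (-δ) * (Cstart * (Cz ^ 2 + 1))) := by
  have hb4 : (4 : ℝ) ≤ b := by exact_mod_cast hb
  have hL := one_le_log_lamPar ha (show 1 ≤ b by omega) N
  have hX := one_le_lamPar (show 1 ≤ a by omega) b N
  have hr := rPar_rpow_le (a := a) (b := b) (s := 1 / 4) (t := 1) (by omega) (by omega) hβ hC
    (by norm_num) (by norm_num) Cz N
  have hr0 := rPar_nonneg (a := a) (b := b) (βp := βp) (zero_le_one.trans hC) Cz N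
  have hL13 : Real.log (lamPar a b N) ≤ Real.log (lamPar a b N) ^ 3 :=
    le_self_pow₀ hL (by norm_num)
  have hY := lamPar_pos (show 0 < a by omega) b (N + 1)
  have hpow : lamPar a b (N + 1) ^ (γ - 3 / 2) ≤ lamPar a b N ^ (-δ) := by
    rw [lamPar_succ_rpow (by omega)]
    exact Real.rpow_le_rpow_of_exponent_le hX (by nlinarith)
  rw [Real.rpow_one] at hr
  unfold EDis
  simp only [Nat.add_sub_cancel]
  calc _ = |ν| * (b * Real.log (lamPar a b N) * lamPar a b (N + 1) ^ (γ - 3 / 2) *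
        rPar a b βp Cstart Cz N ^ ((1 : ℝ) / 4)) := by
        rw [log_lamPar_succ]; ring
    _ ≤ _ := by gcongr

lemma ETrans_succ_le {a b : ℕ} {βp Cstart δ : ℝ} (ha : 3 ≤ a) (hb : 4 ≤ b) (hβ : 0 ≤ βp)
    (hC : 1 ≤ Cstart) (hδ : δ ≤ 1) (Cz : ℝ) (N : ℕ) :
    ETrans a b βp Cstart Cz (N + 1) ≤
      b * Real.log (lamPar a b N) ^ 3 * lamPar a b N ^ (-δ) * (Cstart * (Cz ^ 2 + 1)) := by
  have hb4 : (4 : ℝ) ≤ b := by exact_mod_cast hb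
  have hL := one_le_log_lamPar ha (show 1 ≤ b by omega) N
  have hX := one_le_lamPar (show 1 ≤ a by omega) b N
  have hX0 := zero_lt_one.trans_le hX
  have hr := rPar_rpow_le (a := a) (b := b) (s := 1 / 2) (by omega) (by omega) hβ hC
    (by norm_num) le_rfl Cz N
  have hr0 := rPar_nonneg (a := a) (b := b) (βp := βp) (zero_le_one.trans hC) Cz N
  have hS := SPar_le (a := a) (b := b) ha hb hβ (zero_le_one.trans hC) le_rfl Cz N
  have hS0 := SPar_nonneg (a := a) (b := b) (βp := βp) (show 0 ≤ Cstart by linarith) Cz 0 N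
  rw [Real.rpow_zero, mul_one] at hS
  have hL23 : Real.log (lamPar a b N) ^ 2 ≤ Real.log (lamPar a b N) ^ 3 :=
    pow_le_pow_right₀ hL (by norm_num)
  have hM0 : 0 ≤ Cstart * (Cz ^ 2 + 1) := by positivity
  have hpow : lamPar a b N ^ ((1 : ℝ) / 2) * lamPar a b (N + 1) ^ (-(1 : ℝ) / 2) ≤
      lamPar a b N ^ (-δ) := by
    rw [lamPar_succ_rpow (by omega), ← Real.rpow_add hX0]
    exact Real.rpow_le_rpow_of_exponent_le hX (by linarith)
  unfold ETrans
  simp only [Nat.add_sub_cancel]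
  calc _ = b * Real.log (lamPar a b N) * (lamPar a b N ^ ((1 : ℝ) / 2) *
        lamPar a b (N + 1) ^ (-(1 : ℝ) / 2)) * rPar a b βp Cstart Cz N ^ ((1 : ℝ) / 2) *
        SPar a b βp Cstart Cz 0 N := by
        rw [log_lamPar_succ]; ring
    _ ≤ b * Real.log (lamPar a b N) * lamPar a b N ^ (-δ) *
        (Cstart * (Cz ^ 2 + 1)) ^ ((1 : ℝ) / 2) *
        ((Cstart * (Cz ^ 2 + 1)) ^ ((1 : ℝ) / 2) * Real.log (lamPar a b N)) := by gcongr
    _ = b * Real.log (lamPar a b N) ^ 2 * lamPar a b N ^ (-δ) *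
        ((Cstart * (Cz ^ 2 + 1)) ^ ((1 : ℝ) / 2) * (Cstart * (Cz ^ 2 + 1)) ^ ((1 : ℝ) / 2)) := by
        ring
    _ ≤ _ := by
        rw [rpow_half_mul_self hM0]
        gcongr

lemma ESto_succ_le {a b : ℕ} {βp Cstart Cz δ : ℝ} (ha : 3 ≤ a) (hb : 4 ≤ b) (hβ : 0 ≤ βp)
    (hC : 1 ≤ Cstart) (hCz : 0 ≤ Cz) (hδ : δ ≤ 1) (N : ℕ) :
    ESto a b βp Cstart Cz (N + 1) ≤
      b * Real.log (lamPar a b N) ^ 3 * lamPar a b N ^ (-δ) * (Cstart * (Cz ^ 2 + 1)) := by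
  have hb4 : (4 : ℝ) ≤ b := by exact_mod_cast hb
  have hL := one_le_log_lamPar ha (show 1 ≤ b by omega) N
  have hX := one_le_lamPar (show 1 ≤ a by omega) b N
  have hr := rPar_rpow_le (a := a) (b := b) (s := 1 / 2) (by omega) (by omega) hβ hC
    (by norm_num) le_rfl Cz N
  have hr0 := rPar_nonneg (a := a) (b := b) (βp := βp) (zero_le_one.trans hC) Cz N
  have hCzm := le_sqrt_amplitude (Cz := Cz) hC
  have hL13 : Real.log (lamPar a b N) ≤ Real.log (lamPar a b N) ^ 3 :=
    le_self_pow₀ hL (by norm_num)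
  have hM0 : 0 ≤ Cstart * (Cz ^ 2 + 1) := by positivity
  have hY := lamPar_pos (show 0 < a by omega) b (N + 1)
  have hpow : lamPar a b (N + 1) ^ (-(1 : ℝ) / 2) ≤ lamPar a b N ^ (-δ) := by
    rw [lamPar_succ_rpow (by omega)]
    exact Real.rpow_le_rpow_of_exponent_le hX (by linarith)
  unfold ESto
  simp only [Nat.add_sub_cancel]
  rw [log_lamPar_succ]
  calc _ ≤ b * Real.log (lamPar a b N) ^ 3 * lamPar a b N ^ (-δ) *
        (Cstart * (Cz ^ 2 + 1)) ^ ((1 : ℝ) / 2) *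
        (Cstart * (Cz ^ 2 + 1)) ^ ((1 : ℝ) / 2) := by gcongr
    _ = _ := by rw [mul_assoc, rpow_half_mul_self hM0]

/-- The separation of consecutive frequencies and of the intermediate frequency. -/
lemma frequency_separation {a b : ℕ} (ha : 48 ≤ a) (hb : 4 ≤ b) (N : ℕ) :
    muPar a b (N + 1) ≤ lamPar a b (N + 1) ∧
    12 * lamPar a b N ≤ 4 * muPar a b (N + 1) ∧
    10 ≤ muPar a b (N + 1) ∧
    48 * lamPar a b N ≤ lamPar a b (N + 1) := by
  have hXa : (48 : ℝ) ≤ lamPar a b N := by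
    have h := lamPar_mono (show 1 ≤ a by omega) (show 1 ≤ b by omega) N.zero_le
    rw [lamPar_zero] at h
    exact le_trans (by exact_mod_cast ha) h
  have hXY : lamPar a b N ^ 2 ≤ lamPar a b (N + 1) := by
    rw [lamPar_succ]
    exact pow_le_pow_right₀ (by linarith) (by omega)
  unfold muPar
  simp only [Nat.add_sub_cancel]
  set X := lamPar a b N
  set Y := lamPar a b (N + 1)
  have h48 : 48 * X ≤ Y := by nlinarith
  have h3 : 3 * X ≤ Real.sqrt (X * Y) := Real.le_sqrt_of_sq_le (by nlinarith)
  exact ⟨Real.sqrt_le_iff.2 ⟨by linarith, by nlinarith⟩, by linarith, by linarith, h48⟩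

/-- Choice of convex integration control parameters: let `α > 0`, `κ > 1/2`, `γ < 3/2` and
`ν ∈ ℝ`. Then for every `C > 1` there are `a, b ∈ ℕ` with `a, b ≥ 2` and `β ∈ (0,1)` such
that for all `C_z ≥ 0`, `C_start ≥ 1` and all `n ≥ 1` the control parameters satisfy (R1)
`μ_n ≤ λ_n`, (R2) `ℓ_n ≤ 1`, (R3) `12 λ_{n−1} ≤ 4 μ_n`, `10 ≤ μ_n`, `48 λ_{n−1} ≤ λ_n`, and
`C (𝔈_n^{miss} + 𝔈_n^{com} + 𝔈_n^{time} + 𝔈_n^{dis} + 𝔈_n^{trans} + 𝔈_n^{sto}) ≤ r_n`. -/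
theorem control_parameter_choice (α κ γ ν : ℝ)
    (hα : 0 < α) (hκ : 1 / 2 < κ) (hγ : γ < 3 / 2) :
    ∀ C : ℝ, 1 < C →
      ∃ (a b : ℕ) (βp : ℝ), 2 ≤ a ∧ 2 ≤ b ∧ 0 < βp ∧ βp < 1 ∧
        ∀ Cz : ℝ, 0 ≤ Cz → ∀ Cstart : ℝ, 1 ≤ Cstart → ∀ n : ℕ, 1 ≤ n →
          muPar a b n ≤ lamPar a b n ∧
          ellPar a b n ≤ 1 ∧
          12 * lamPar a b (n - 1) ≤ 4 * muPar a b n ∧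
          10 ≤ muPar a b n ∧
          48 * lamPar a b (n - 1) ≤ lamPar a b n ∧
          C * (EMiss a b βp Cstart Cz n + ECom a b βp Cstart Cz α κ n +
              ETime a b βp Cstart Cz n + EDis a b βp Cstart Cz γ ν n +
              ETrans a b βp Cstart Cz n + ESto a b βp Cstart Cz n) ≤
            rPar a b βp Cstart Cz n := by
  intro C hC1
  obtain ⟨δ, hδ0, hδ1, hδκ, hδγ⟩ : ∃ δ : ℝ, 0 < δ ∧ δ ≤ 1 ∧ δ ≤ κ - 1 / 2 ∧ δ ≤ 3 / 2 - γ :=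
    ⟨min 1 (min (κ - 1 / 2) (3 / 2 - γ)), lt_min one_pos (lt_min (by linarith) (by linarith)), min_le_left _ _,
      (min_le_right _ _).trans (min_le_left _ _), (min_le_right _ _).trans (min_le_right _ _)⟩
  obtain ⟨b, hb, hbα⟩ : ∃ b : ℕ, 4 ≤ b ∧ 2 + α ≤ b * α := by
    obtain ⟨b, hb⟩ := exists_nat_ge ((2 + α) / α)
    refine ⟨max 4 b, le_max_left _ _, (div_le_iff₀ hα).1 (hb.trans ?_)⟩
    exact_mod_cast le_max_right 4 b
  have hb4 : (4 : ℝ) ≤ b := by exact_mod_cast hb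
  obtain ⟨a, ha, hlog⟩ :=
    exists_nat_forall_log_pow_le (C * ((13 + |ν|) * b)) (half_pos hδ0) 3
  have hβ : 0 < δ / (2 * b) := by positivity
  refine ⟨a, b, δ / (2 * b), by omega, by omega, hβ, ?_, ?_⟩
  · rw [div_lt_one (by positivity)]
    linarith
  intro Cz hCz Cstart hCs n hn
  obtain ⟨N, rfl⟩ : ∃ N, n = N + 1 := ⟨n - 1, by omega⟩
  obtain ⟨hμ, h12, h10, h48⟩ := frequency_separation ha hb N
  refine ⟨hμ, inv_le_one_of_one_le₀ (one_le_lamPar (by omega) b _), h12, h10, h48, ?_⟩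
  have ha3 : 3 ≤ a := by omega
  have hC0 : 0 ≤ Cstart := by linarith
  have e1 := EMiss_succ_le ha3 hb hβ.le hC0 hδ1 Cz N
  have e2 := ECom_succ_le ha3 hb hβ.le hCs hCz hα.le hδ1 hδκ hbα N
  have e3 := ETime_succ_le ha3 hb hβ.le hCs hδ1 Cz N
  have e4 := EDis_succ_le ha3 hb hβ.le hCs hγ.le hδγ ν Cz N
  have e5 := ETrans_succ_le ha3 hb hβ.le hCs hδ1 Cz N
  have e6 := ESto_succ_le ha3 hb hβ.le hCs hCz hδ1 N
  have hX0 := lamPar_pos (show 0 < a by omega) b N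
  have hloga := hlog (lamPar a b N) (by
    rw [← lamPar_zero a b]
    exact lamPar_mono (by omega) (by omega) N.zero_le)
  calc _ ≤ C * ((13 + |ν|) * (b * Real.log (lamPar a b N) ^ 3 * lamPar a b N ^ (-δ) *
        (Cstart * (Cz ^ 2 + 1)))) := by
        refine mul_le_mul_of_nonneg_left ?_ (by linarith)
        linarith
    _ = C * ((13 + |ν|) * b) * Real.log (lamPar a b N) ^ 3 * lamPar a b N ^ (-δ) *
        (Cstart * (Cz ^ 2 + 1)) := by ring
    _ ≤ lamPar a b N ^ (δ / 2) * lamPar a b N ^ (-δ) * (Cstart * (Cz ^ 2 + 1)) := by gcongr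
    _ = Cstart * (Cz ^ 2 + 1) * lamPar a b (N + 1) ^ (-(δ / (2 * b))) := by
        rw [lamPar_succ_rpow (by omega), ← Real.rpow_add hX0, mul_comm]
        congr 2
        field_simp
        ring
    _ ≤ _ := le_rPar (by omega) hβ.le hC0 Cz (N + 1)
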